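/- arXiv:2510.09776 — 2 statements merged into one kernel-verified Lean document; each statement's English description precedes it below -/
import Mathlib

section
/- Let p ≥ 1, n ≥ p+1, and x_1,…,x_n ∈ ℝ. Let H ∈ ℝ^{(p+1)×(n−p+1)} be the Hankel matrix of x_1,…,x_n, let M = diag(I_{n−p}, 0) ∈ ℝ^{(n−p+1)×(n−p+1)}, and define LSA(H) = H + (1/n) P H M (Hᵀ Q H). Suppose P ∈ ℝ^{(p+1)×(p+1)} has all rows zero except its last row, which equals bᵀ for some b ∈ ℝ^{p+1}, and Q = [A 0] ∈ ℝ^{(p+1)×(p+1)} with A ∈ ℝ^{(p+1)×p}. Then the entry of LSA(H) in row p+1 and column n−p+1 equals bᵀ G_n A x_{n−p+1:n}, where G_n := (1/n) Σ_{i=1}^{n−p} x^{(i)} x^{(i)ᵀ} and x_{n−p+1:n} := (x_{n−p+1},…,x_n)ᵀ ∈ ℝ^p. -/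
open Matrix Finset

/-- Hankel matrix of the (1-based) data `x 1, …, x n` with context length `p`:
column `j` (0-based, `j < n - p`) is the window `(x (j+1), …, x (j+1+p))`, and the last
column is `(x (n-p+1), …, x n, 0)` with a zero label slot. -/
noncomputable def hankelMatrix (p n : ℕ) (x : ℕ → ℝ) :
    Matrix (Fin (p + 1)) (Fin (n - p + 1)) ℝ :=
  Matrix.of fun i j => if (i : ℕ) = p ∧ (j : ℕ) = n - p then 0 else x (j + 1 + i)

/-- The causal mask `M = diag(I_{n-p}, 0)`. -/
noncomputable def lsaMask (p n : ℕ) : Matrix (Fin (n - p + 1)) (Fin (n - p + 1)) ℝ :=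
  Matrix.diagonal fun j => if (j : ℕ) < n - p then 1 else 0

/-- The empirical Hankel Gram matrix `G_n = (1/n) ∑_{i=1}^{n-p} x⁽ⁱ⁾ x⁽ⁱ⁾ᵀ`,
where `x⁽ⁱ⁾ = (x i, …, x (i+p))ᵀ`. -/
noncomputable def gramMatrix (p n : ℕ) (x : ℕ → ℝ) :
    Matrix (Fin (p + 1)) (Fin (p + 1)) ℝ :=
  (n : ℝ)⁻¹ • ∑ i ∈ Finset.Icc 1 (n - p),
    Matrix.vecMulVec (fun j : Fin (p + 1) => x (i + j)) (fun j : Fin (p + 1) => x (i + j))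

theorem hankel_gram_aux (p n : ℕ) (x : ℕ → ℝ) :
    (n : ℝ)⁻¹ • (hankelMatrix p n x * (lsaMask p n * (hankelMatrix p n x)ᵀ)) = gramMatrix p n x := by
  unfold gramMatrix
  congr 1
  ext i k
  rw [Matrix.sum_apply, Matrix.mul_apply, Fin.sum_univ_castSucc]
  have h1 : ∀ f : ℕ → ℝ, ∑ t ∈ Finset.Icc 1 (n - p), f t = ∑ j : Fin (n - p), f (j + 1) := by
    intro f
    rw [Fin.sum_univ_eq_sum_range (fun j => f (j + 1)), Finset.range_eq_Ico,
      Finset.sum_Ico_add' f 0 (n - p) 1]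
    rfl
  rw [h1 (fun t => (Matrix.vecMulVec (fun j : Fin (p + 1) => x (t + j))
    (fun j : Fin (p + 1) => x (t + j))) i k)]
  have h2 : hankelMatrix p n x i (Fin.last (n - p)) *
      (lsaMask p n * (hankelMatrix p n x)ᵀ) (Fin.last (n - p)) k = 0 := by
    simp [lsaMask, Matrix.diagonal_mul]
  rw [h2, add_zero]
  refine Finset.sum_congr rfl fun j _ => ?_
  have hj := j.isLt
  have hj' : (j : ℕ) ≠ n - p := by omega
  simp [lsaMask, Matrix.diagonal_mul, hankelMatrix, Matrix.vecMulVec_apply, hj']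

theorem hankel_query_aux (p n : ℕ) (x : ℕ → ℝ) (A : Matrix (Fin (p + 1)) (Fin p) ℝ)
    (Q : Matrix (Fin (p + 1)) (Fin (p + 1)) ℝ)
    (hQ : ∀ i j, Q i j = if h : (j : ℕ) < p then A i ⟨j, h⟩ else 0)
    (k : Fin (p + 1)) (l : Fin (n - p + 1)) (hl : (l : ℕ) = n - p) :
    (Q * hankelMatrix p n x) k l = (A *ᵥ fun k : Fin p => x (n - p + 1 + k)) k := by
  rw [Matrix.mul_apply, Fin.sum_univ_castSucc]
  simp only [Matrix.mulVec, dotProduct, hQ]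
  have : ∀ j : Fin p, (j : ℕ) ≠ p := fun j => by omega
  simp [hankelMatrix, hl, this]

/-- **Closed-form readout of one-layer LSA on Hankel input.**
If `P` has all rows zero except its last row `bᵀ`, and `Q = [A 0]`, then the entry of
`LSA(H) = H + (1/n) P H M (Hᵀ Q H)` in row `p+1`, column `n-p+1` equals
`bᵀ G_n A x_{n-p+1:n}`. -/
theorem lsa_closed_form_readout (p n : ℕ) (hp : 1 ≤ p) (hn : p + 1 ≤ n) (x : ℕ → ℝ)
    (b : Fin (p + 1) → ℝ) (A : Matrix (Fin (p + 1)) (Fin p) ℝ)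
    (P Q : Matrix (Fin (p + 1)) (Fin (p + 1)) ℝ)
    (hP : ∀ i j, P i j = if (i : ℕ) = p then b j else 0)
    (hQ : ∀ i j, Q i j = if h : (j : ℕ) < p then A i ⟨j, h⟩ else 0) :
    (hankelMatrix p n x + (n : ℝ)⁻¹ •
        (P * (hankelMatrix p n x *
          (lsaMask p n * ((hankelMatrix p n x)ᵀ * (Q * hankelMatrix p n x))))))
      ⟨p, by omega⟩ ⟨n - p, by omega⟩
      = b ⬝ᵥ ((gramMatrix p n x * A) *ᵥ fun k : Fin p => x (n - p + 1 + k)) := by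
  have e : (n : ℝ)⁻¹ • (P * (hankelMatrix p n x *
          (lsaMask p n * ((hankelMatrix p n x)ᵀ * (Q * hankelMatrix p n x))))) =
      P * (gramMatrix p n x * (Q * hankelMatrix p n x)) := by
    rw [← hankel_gram_aux]
    simp only [Matrix.mul_assoc, Matrix.smul_mul, Matrix.mul_smul]
  rw [e, Matrix.add_apply, Matrix.mul_apply, ← Matrix.mulVec_mulVec]
  have h0 : hankelMatrix p n x ⟨p, by omega⟩ ⟨n - p, by omega⟩ = 0 := by simp [hankelMatrix]
  rw [h0, zero_add]
  simp only [dotProduct]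
  refine Finset.sum_congr rfl fun i _ => ?_
  rw [hP, if_pos rfl, Matrix.mul_apply]
  congr 1
  simp only [Matrix.mulVec, dotProduct]
  refine Finset.sum_congr rfl fun k _ => ?_
  rw [hankel_query_aux p n x A Q hQ k _ rfl]
  rfl
end

section
/- Let p ≥ 1 and γ_0, γ_1, …, γ_p ∈ ℝ. Let Γ_{p+1} ∈ ℝ^{(p+1)×(p+1)} be the symmetric Toeplitz matrix with entries (Γ_{p+1})_{ij} = γ_{|i−j|}, let Γ_p be its top-left p×p block, assumed invertible, and set γ := (γ_1,…,γ_p)ᵀ and ρ := Γ_p⁻¹ γ (the Yule–Walker solution). Let J ∈ ℝ^{p×p} be the anti-diagonal (reversal) permutation matrix, b* := e_{p+1} ∈ ℝ^{p+1} the last standard basis vector, and A* := [J Γ_p⁻¹ ; 0_{1×p}] ∈ ℝ^{(p+1)×p} (the matrix whose first p rows are J Γ_p⁻¹ and whose last row is zero). Then b*ᵀ Γ_{p+1} A* = ρᵀ; i.e., with these parameters the population-limit one-layer LSA readout b*ᵀ Γ_{p+1} A* x equals the Bayes-optimal linear prediction ρᵀ x for every x ∈ ℝ^p. -/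
open Matrix

/-- **Asymptotic exact recovery: a constructive parameter choice.**
With `Γ_{p+1}` the symmetric Toeplitz matrix of `γ_0, …, γ_p`, `Γ_p` its invertible
top-left `p×p` block, `ρ := Γ_p⁻¹ (γ_1,…,γ_p)ᵀ` the Yule–Walker solution, `J` the
reversal permutation, `b* = e_{p+1}` and `A* = [J Γ_p⁻¹ ; 0]`, one has
`b*ᵀ Γ_{p+1} A* = ρᵀ`; equivalently the population-limit one-layer LSA readout
`b*ᵀ Γ_{p+1} A* x` equals `ρᵀ x` for every `x ∈ ℝᵖ`. -/
theorem lsa_population_recovery (p : ℕ) (hp : 1 ≤ p) (γ : ℕ → ℝ)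
    (Γp1 : Matrix (Fin (p + 1)) (Fin (p + 1)) ℝ)
    (hΓp1 : Γp1 = Matrix.of fun i j : Fin (p + 1) => γ ((i : ℤ) - (j : ℤ)).natAbs)
    (Γp : Matrix (Fin p) (Fin p) ℝ)
    (hΓp : Γp = Matrix.of fun s t : Fin p => γ ((s : ℤ) - (t : ℤ)).natAbs)
    (hinv : IsUnit Γp.det)
    (ρ : Fin p → ℝ) (hρ : ρ = Γp⁻¹ *ᵥ fun k : Fin p => γ ((k : ℕ) + 1))
    (J : Matrix (Fin p) (Fin p) ℝ)
    (hJ : J = Matrix.of fun i j : Fin p => if (i : ℕ) + (j : ℕ) = p - 1 then (1:ℝ) else 0)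
    (bstar : Fin (p + 1) → ℝ) (hb : bstar = Pi.single ⟨p, Nat.lt_succ_self p⟩ 1)
    (Astar : Matrix (Fin (p + 1)) (Fin p) ℝ)
    (hA : Astar = Matrix.of fun (i : Fin (p + 1)) (k : Fin p) =>
        if h : (i : ℕ) < p then (J * Γp⁻¹) ⟨i, h⟩ k else 0) :
    bstar ᵥ* (Γp1 * Astar) = ρ
      ∧ ∀ v : Fin p → ℝ, bstar ⬝ᵥ ((Γp1 * Astar) *ᵥ v) = ρ ⬝ᵥ v := by
  have hsymm : Γpᵀ = Γp := by
    subst hΓp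
    ext i j
    simp only [Matrix.transpose_apply, Matrix.of_apply]
    congr 1
    omega
  have hsi : ∀ a b, Γp⁻¹ a b = Γp⁻¹ b a := by
    intro a b
    have h : (Γp⁻¹)ᵀ = Γp⁻¹ := by rw [Matrix.transpose_nonsing_inv, hsymm]
    exact (congrFun (congrFun h a) b).symm.trans rfl |>.trans (by rw [Matrix.transpose_apply])
  have hJm : ∀ (j k : Fin p), (J * Γp⁻¹) j k = Γp⁻¹ (Fin.rev j) k := by
    intro j k
    rw [Matrix.mul_apply, Finset.sum_eq_single (Fin.rev j)]
    · have : (j : ℕ) + (Fin.rev j : ℕ) = p - 1 := by rw [Fin.val_rev]; omega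
      rw [hJ, Matrix.of_apply, if_pos this, one_mul]
    · intro l _ hl
      have : ¬ ((j : ℕ) + (l : ℕ) = p - 1) := by
        intro h
        apply hl
        ext
        rw [Fin.val_rev]
        omega
      rw [hJ, Matrix.of_apply, if_neg this, zero_mul]
    · intro h
      exact absurd (Finset.mem_univ _) h
  have main : bstar ᵥ* (Γp1 * Astar) = ρ := by
    ext k
    rw [hb, Matrix.single_one_vecMul, hρ]
    simp only [Matrix.row_apply, Matrix.mul_apply, Matrix.mulVec, dotProduct]
    rw [Fin.sum_univ_castSucc]
    have hlast : Astar (Fin.last p) k = 0 := by simp [hA]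
    rw [hlast, mul_zero, add_zero, ← Equiv.sum_comp Fin.revPerm]
    refine Finset.sum_congr rfl fun l _ => ?_
    have h1 : Astar (Fin.castSucc (Fin.revPerm l)) k = Γp⁻¹ l k := by
      have h2 := hJm (Fin.rev l) k
      rw [Fin.rev_rev] at h2
      rw [hA, Matrix.of_apply, dif_pos (by simp; omega), ← h2]
      rfl
    rw [h1, hsi l k, mul_comm, hΓp1, Matrix.of_apply]
    congr 2
    simp only [Fin.val_castSucc, Fin.revPerm_apply, Fin.val_rev]
    omega
  refine ⟨main, fun v => ?_⟩
  rw [Matrix.dotProduct_mulVec, main]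
end
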